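/- arXiv:1407.2977 — 2 statements merged into one kernel-verified Lean document; each statement's English description precedes it below -/
import Mathlib

section
/- Let X be a real Banach space admitting a C¹ Lipschitz bump function, let p ∈ X, δ > 0 and K ≥ 0. Let f : B(p,4δ) → ℝ be a lower semicontinuous function defined on the open ball of center p and radius 4δ, such that ‖ξ‖ ≤ K for every x ∈ B(p,4δ) and every ξ ∈ D⁻f(x). Then f is K-Lipschitz on B(p,δ), i.e. |f(x) − f(y)| ≤ K‖x − y‖ for all x, y ∈ B(p,δ). -/
open Filter Topology

variable {X : Type*} [NormedAddCommGroup X] [NormedSpace ℝ X]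

/-- `X` admits a `C¹` Lipschitz bump function. -/
def HasC1LipBump (X : Type*) [NormedAddCommGroup X] [NormedSpace ℝ X] : Prop :=
  ∃ b : X → ℝ, ContDiff ℝ 1 b ∧ (∃ K : NNReal, LipschitzWith K b) ∧
    Bornology.IsBounded (Function.support b) ∧ (Function.support b).Nonempty

/-- The Fréchet subdifferential at `x` of a real-valued function `f` regarded as a
function defined on the set `Ω`. -/
def subdiffOn (Ω : Set X) (f : X → ℝ) (x : X) : Set (X →L[ℝ] ℝ) :=
  {Δ | ∀ ε > (0:ℝ), ∃ δ > (0:ℝ), ∀ h : X, ‖h‖ < δ → x + h ∈ Ω →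
    f x + Δ h - ε * ‖h‖ ≤ f (x + h)}

/-- A `C¹` Lipschitz bump function can be normalised to take values in `[0, 1]`, equal `1` at the
origin and vanish outside the unit ball. -/
theorem HasC1LipBump.exists_normalized (h : HasC1LipBump X) :
    ∃ b : X → ℝ, ∃ b' : X → X →L[ℝ] ℝ, ∃ C : ℝ, 0 ≤ C ∧ (∀ x, HasFDerivAt b (b' x) x) ∧
      (∀ x, ‖b' x‖ ≤ C) ∧ (∀ x, 0 ≤ b x) ∧ (∀ x, b x ≤ 1) ∧ b 0 = 1 ∧
      ∀ x, 1 ≤ ‖x‖ → b x = 0 := by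
  obtain ⟨b, hb, ⟨L, hL⟩, hbdd, x₀, hx₀⟩ := h
  obtain ⟨R, hR⟩ := hbdd.subset_ball x₀
  have hRpos : 0 < R := by simpa using Metric.nonempty_ball.1 ⟨_, hR hx₀⟩
  have hd : Differentiable ℝ b := hb.differentiable (by simp)
  set c : ℝ := Real.pi / b x₀ with hc
  have hder : ∀ x, HasFDerivAt (fun x => (1 - Real.cos (c * b (x₀ + R • x))) / 2)
      ((2⁻¹ * Real.sin (c * b (x₀ + R • x)) * c * R) • fderiv ℝ b (x₀ + R • x)) x := by
    intro x
    have h1 : HasFDerivAt (fun x : X => x₀ + R • x) (R • ContinuousLinearMap.id ℝ X) x :=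
      ((hasFDerivAt_id x).const_smul R).const_add x₀
    have h2 := ((hd (x₀ + R • x)).hasFDerivAt.comp x h1).const_mul c
    have h3 := (h2.cos.const_sub 1).mul_const (2⁻¹ : ℝ)
    refine (h3.congr_fderiv ?_).congr_of_eventuallyEq ?_
    · ext v
      simp
      ring
    · exact Eventually.of_forall fun y => by simp [div_eq_mul_inv]
  refine ⟨_, _, |c| * R * L, by positivity, hder, fun x => ?_, fun x => ?_, fun x => ?_, ?_,
    fun x hx => ?_⟩
  · rw [norm_smul, Real.norm_eq_abs, abs_mul, abs_mul, abs_mul, abs_of_pos hRpos]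
    have h1 := Real.abs_sin_le_one (c * b (x₀ + R • x))
    have h2 : |(2⁻¹ : ℝ)| * |Real.sin (c * b (x₀ + R • x))| ≤ 1 := by
      rw [abs_of_pos (by norm_num)]
      linarith
    have h3 : |(2⁻¹ : ℝ)| * |Real.sin (c * b (x₀ + R • x))| * |c| * R ≤ |c| * R := by
      calc _ ≤ 1 * |c| * R := by gcongr
        _ = _ := by ring
    gcongr
    exact norm_fderiv_le_of_lipschitz ℝ hL
  · linarith [Real.cos_le_one (c * b (x₀ + R • x))]
  · linarith [Real.neg_one_le_cos (c * b (x₀ + R • x))]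
  · simp only [smul_zero, add_zero, hc, div_mul_cancel₀ _ (Function.mem_support.1 hx₀), Real.cos_pi]
    norm_num
  · have : b (x₀ + R • x) = 0 := by
      by_contra hne
      have h := hR (Function.mem_support.2 hne)
      rw [mem_ball_iff_norm, add_sub_cancel_left, norm_smul, Real.norm_of_nonneg hRpos.le] at h
      nlinarith
    simp [this]

/-- A smooth variational principle: a lower semicontinuous function which is bounded below on a
closed set attains its minimum after a small perturbation with small derivative. -/
theorem HasC1LipBump.exists_isMinOn_add [CompleteSpace X] (h : HasC1LipBump X) {S : Set X}
    (hS : IsClosed S) (hne : S.Nonempty) {F : X → ℝ} (hF : LowerSemicontinuousOn F S) {m : ℝ}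
    (hm : ∀ z ∈ S, m ≤ F z) {ε : ℝ} (hε : 0 < ε) :
    ∃ g : X → ℝ, ∃ g' : X → X →L[ℝ] ℝ, (∀ x, HasFDerivAt g (g' x) x) ∧ (∀ x, ‖g' x‖ ≤ ε) ∧
      (∀ x, g x ≤ 0) ∧ (∀ x, -ε ≤ g x) ∧ ∃ u ∈ S, ∀ z ∈ S, F u + g u ≤ F z + g z := by
  obtain ⟨b, b', C, hC, hb', hbC, hb0, hb1, hb00, hbs⟩ := h.exists_normalized
  set a : ℝ := ε / (2 * (1 + C)) with ha
  have hapos : 0 < a := by positivity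
  have haC : a * (1 + C) = ε / 2 := by
    rw [ha]
    field_simp
  set d : ℕ → ℝ := fun n => a * (1 / 8) ^ n with hd
  have hdpos : ∀ n, 0 < d n := fun n => by positivity
  have hdsucc : ∀ n, d (n + 1) = d n / 8 := fun n => by
    simp only [hd, pow_succ]
    ring
  have hdanti : Antitone d := antitone_nat_of_succ_le fun n => by
    rw [hdsucc]
    linarith [hdpos n]
  have hdlim : Tendsto d atTop (𝓝 0) := by
    simpa only [mul_zero] using (tendsto_pow_atTop_nhds_zero_of_lt_one (r := (1 / 8 : ℝ))
      (by norm_num) (by norm_num)).const_mul a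
  have hsel : ∀ (G : X → ℝ) (n : ℕ), (∃ c, ∀ z, c ≤ G z) →
      ∃ x ∈ S, ∀ z ∈ S, F x + G x ≤ F z + G z + d n / 2 := by
    rintro G n ⟨c, hc⟩
    have hbd : BddBelow ((fun z => F z + G z) '' S) := by
      refine ⟨m + c, ?_⟩
      rintro _ ⟨z, hz, rfl⟩
      exact add_le_add (hm z hz) (hc z)
    obtain ⟨_, ⟨x, hx, rfl⟩, hlt⟩ := exists_lt_of_csInf_lt (hne.image fun z => F z + G z)
      (lt_add_of_pos_right (sInf ((fun z => F z + G z) '' S)) (half_pos (hdpos n)))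
    refine ⟨x, hx, fun z hz => hlt.le.trans ?_⟩
    gcongr
    exact csInf_le hbd ⟨z, hz, rfl⟩
  choose! sel hselS hselmin using hsel
  let G : ℕ → X → ℝ := fun n => Nat.rec (fun _ => 0)
    (fun n G z => G z - d n * b ((2 : ℝ) ^ n • (z - sel G n))) n
  set x : ℕ → X := fun n => sel (G n) n with hx
  set T : ℕ → X → ℝ := fun n z => d n * b ((2 : ℝ) ^ n • (z - x n)) with hT
  have hG0 : ∀ z, G 0 z = 0 := fun z => rfl
  have hGs : ∀ n z, G (n + 1) z = G n z - T n z := fun n z => rfl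
  have hT0 : ∀ n z, 0 ≤ T n z := fun n z => mul_nonneg (hdpos n).le (hb0 _)
  have hTd : ∀ n z, T n z ≤ d n := fun n z => mul_le_of_le_one_right (hdpos n).le (hb1 _)
  have hGanti : ∀ z, Antitone fun n => G n z := fun z => antitone_nat_of_succ_le fun n => by
    linarith [hGs n z, hT0 n z]
  have hGmono : ∀ z, Monotone fun n => G n z - 8 / 7 * d n := fun z =>
    monotone_nat_of_le_succ fun n => by linarith [hGs n z, hTd n z, hdsucc n]
  have hxsel : ∀ n, x n ∈ S ∧ ∀ z ∈ S, F (x n) + G n (x n) ≤ F z + G n z + d n / 2 := by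
    intro n
    have hbd : ∃ c, ∀ z, c ≤ G n z := ⟨-(8 / 7 * d 0), fun z => by
      have := hGmono z (Nat.zero_le n)
      simp only [hG0] at this
      linarith [hdpos n]⟩
    exact ⟨hselS _ n hbd, hselmin _ n hbd⟩
  have hTsum : ∀ z, Summable fun n => T n z := fun z =>
    Summable.of_nonneg_of_le (fun n => hT0 n z) (fun n => hTd n z)
      ((summable_geometric_of_lt_one (by norm_num) (by norm_num)).mul_left a)
  have hGsum : ∀ n z, G n z = -∑ k ∈ Finset.range n, T k z := by
    intro n z
    induction n with
    | zero => simp [hG0]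
    | succ n ih => rw [hGs, ih, Finset.sum_range_succ]; ring
  set g : X → ℝ := fun z => -∑' n, T n z with hg
  have hGlim : ∀ z, Tendsto (fun n => G n z) atTop (𝓝 (g z)) := fun z => by
    simpa only [hGsum] using (hTsum z).hasSum.tendsto_sum_nat.neg
  have hgG : ∀ n z, g z ≤ G n z := fun n z => (hGanti z).le_of_tendsto (hGlim z) n
  have hGg : ∀ n z, G n z - 8 / 7 * d n ≤ g z := fun n z => by
    refine (hGmono z).ge_of_tendsto ?_ n
    simpa using (hGlim z).sub (hdlim.const_mul (8 / 7))
  set T' : ℕ → X → X →L[ℝ] ℝ := fun n z => (d n * 2 ^ n) • b' ((2 : ℝ) ^ n • (z - x n)) with hT'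
  have hTder : ∀ n z, HasFDerivAt (T n) (T' n z) z := by
    intro n z
    have h1 : HasFDerivAt (fun z : X => (2 : ℝ) ^ n • (z - x n))
        ((2 : ℝ) ^ n • ContinuousLinearMap.id ℝ X) z :=
      ((hasFDerivAt_id z).sub_const (x n)).const_smul _
    refine (((hb' _).comp z h1).const_mul (d n)).congr_fderiv ?_
    ext v
    simp [hT', mul_assoc]
  set w : ℕ → ℝ := fun n => a * C * (1 / 4) ^ n with hw
  have hwsum : HasSum w (a * C * (4 / 3)) := by
    have := (hasSum_geometric_of_lt_one (r := (1 / 4 : ℝ)) (by norm_num) (by norm_num)).mul_left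
      (a * C)
    rwa [show (1 - 1 / 4 : ℝ)⁻¹ = 4 / 3 by norm_num] at this
  have hT'w : ∀ n z, ‖T' n z‖ ≤ w n := by
    intro n z
    have h1 : d n * 2 ^ n = a * (1 / 4) ^ n := by
      rw [hd, mul_assoc, ← mul_pow]
      norm_num
    simp only [hT', norm_smul, h1, Real.norm_eq_abs, hw]
    rw [abs_of_nonneg (by positivity)]
    calc _ ≤ a * (1 / 4) ^ n * C := by gcongr; exact hbC _
      _ = _ := by ring
  have hgder : ∀ z, HasFDerivAt g (-∑' n, T' n z) z := fun z =>
    (hasFDerivAt_tsum hwsum.summable hTder hT'w (hTsum 0) z).neg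
  have hdist : ∀ n k, n < k → ‖x k - x n‖ < (1 / 2) ^ n := by
    intro n k hnk
    by_contra! hle
    have hzero : T n (x k) = 0 := by
      simp only [hT]
      rw [hbs _ ?_, mul_zero]
      rw [norm_smul, norm_pow, Real.norm_ofNat]
      calc (1 : ℝ) = 2 ^ n * (1 / 2) ^ n := by rw [← mul_pow]; norm_num
        _ ≤ _ := by gcongr
    have hone : T n (x n) = d n := by simp [hT, hb00]
    have h1 := hGmono (x k) (Nat.succ_le_of_lt hnk)
    have h2 := hGanti (x n) (Nat.succ_le_of_lt hnk)
    have h3 := hdanti (Nat.succ_le_of_lt hnk)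
    simp only [Nat.succ_eq_add_one, hGs, hdsucc] at h1 h2 h3
    have h4 := (hxsel n).2 _ (hxsel k).1
    have h5 := (hxsel k).2 _ (hxsel n).1
    linarith [hdpos n, hdpos k]
  have hcau : CauchySeq x := by
    refine cauchySeq_of_le_geometric (1 / 2) 1 (by norm_num) fun n => ?_
    rw [dist_comm, dist_eq_norm, one_mul]
    exact (hdist n (n + 1) n.lt_succ_self).le
  obtain ⟨u, hu⟩ := cauchySeq_tendsto_of_complete hcau
  have huS : u ∈ S := hS.mem_of_tendsto hu (Eventually.of_forall fun n => (hxsel n).1)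
  have hd0 : d 0 = a := by simp [hd]
  refine ⟨g, _, hgder, fun z => ?_, fun z => ?_, fun z => ?_, u, huS, fun z hz => ?_⟩
  · rw [norm_neg]
    refine (tsum_of_norm_bounded hwsum fun n => hT'w n z).trans ?_
    nlinarith
  · simpa [hG0] using hgG 0 z
  · have := hGg 0 z
    rw [hG0, hd0] at this
    nlinarith [mul_nonneg hapos.le hC]
  · refine le_of_forall_pos_le_add fun η hη => ?_
    have h1 : ∀ᶠ n in atTop, F u - η / 4 < F (x n) :=
      (tendsto_nhdsWithin_iff.2 ⟨hu, Eventually.of_forall fun n => (hxsel n).1⟩).eventually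
        (hF u huS _ (by linarith))
    have h2 : ∀ᶠ n in atTop, g u - η / 4 < g (x n) :=
      ((hgder u).continuousAt.tendsto.comp hu).eventually (lt_mem_nhds (by linarith))
    have h3 : ∀ᶠ n in atTop, d n < η / 4 := hdlim.eventually (gt_mem_nhds (by linarith))
    obtain ⟨n, h1, h2, h3⟩ := (h1.and (h2.and h3)).exists
    linarith [(hxsel n).2 z hz, hGg n z, hgG n (x n)]

/-- A lower semicontinuous function is bounded below near a compact set. -/
theorem LowerSemicontinuousOn.exists_eventually_nhdsSet_le {Y : Type*} [TopologicalSpace Y]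
    {Ω A : Set Y} {f : Y → ℝ} (hΩ : IsOpen Ω) (hf : LowerSemicontinuousOn f Ω) (hA : IsCompact A)
    (hAΩ : A ⊆ Ω) :
    ∃ m, ∀ᶠ z in 𝓝ˢ A, m ≤ f z := by
  have hloc : ∀ a ∈ A, ∃ t ∈ 𝓝[A] a, ∃ m, ∀ᶠ z in 𝓝ˢ t, m ≤ f z := by
    intro a ha
    have h1 : ∀ᶠ z in 𝓝 a, f a - 1 < f z := by
      have h2 := hf a (hAΩ ha) (f a - 1) (by linarith)
      rwa [hΩ.nhdsWithin_eq (hAΩ ha)] at h2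
    obtain ⟨t, ht, hto, hat⟩ := eventually_nhds_iff.1 h1
    exact ⟨t, mem_nhdsWithin_of_mem_nhds (hto.mem_nhds hat), f a - 1,
      mem_of_superset (hto.mem_nhdsSet.2 subset_rfl) fun z hz => (ht z hz).le⟩
  refine hA.induction_on (p := fun t => ∃ m, ∀ᶠ z in 𝓝ˢ t, m ≤ f z) ⟨0, by simp⟩ ?_ ?_ hloc
  · rintro s t hst ⟨m, hm⟩
    exact ⟨m, hm.filter_mono (nhdsSet_mono hst)⟩
  · rintro s t ⟨m, hm⟩ ⟨n, hn⟩
    refine ⟨min m n, ?_⟩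
    rw [nhdsSet_union, eventually_sup]
    exact ⟨hm.mono fun z hz => (min_le_left _ _).trans hz,
      hn.mono fun z hz => (min_le_right _ _).trans hz⟩

/-- If a perturbation `f + φ` of `f` has a local minimum at a point of differentiability of `φ`,
then the negative of the derivative of `φ` is a Fréchet subgradient of `f` there. -/
theorem IsLocalMin.neg_mem_subdiffOn {Ω : Set X} {f φ : X → ℝ} {φ' : X →L[ℝ] ℝ} {u : X}
    (h : IsLocalMin (f + φ) u) (hφ : HasFDerivAt φ φ' u) : -φ' ∈ subdiffOn Ω f u := by
  intro ε hε
  have h1 := (hasFDerivAt_iff_isLittleO_nhds_zero.1 hφ).def hε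
  have hadd : Tendsto (fun v : X => u + v) (𝓝 0) (𝓝 u) :=
    (continuous_const.add continuous_id).tendsto' _ _ (by simp)
  obtain ⟨r, hr, hball⟩ := Metric.eventually_nhds_iff.1 (h1.and (hadd.eventually h))
  refine ⟨r, hr, fun v hv _ => ?_⟩
  obtain ⟨h2, h3⟩ := hball (y := v) (by simpa using hv)
  have h4 := (abs_le.1 (Real.norm_eq_abs _ ▸ h2)).2
  simp only [Pi.add_apply] at h3
  rw [neg_apply]
  linarith

/-- One-sided mean value inequality along a segment. -/
theorem sub_le_of_forall_subdiffOn_norm_le [CompleteSpace X] (hbump : HasC1LipBump X) {Ω : Set X}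
    (hΩ : IsOpen Ω) {K : ℝ} (hK : 0 ≤ K) {f : X → ℝ} (hf : LowerSemicontinuousOn f Ω)
    (hsub : ∀ x ∈ Ω, ∀ ξ ∈ subdiffOn Ω f x, ‖ξ‖ ≤ K) {x y : X} (hxy : segment ℝ x y ⊆ Ω) :
    f y - f x ≤ K * ‖y - x‖ := by
  by_contra! hlt
  obtain ⟨L, hKL, hL⟩ := exists_between hlt
  obtain ⟨b, b', C, -, hb', -, hb0, hb1, hb00, hbs⟩ := hbump.exists_normalized
  have hbc : Continuous b := continuous_iff_continuousAt.2 fun z => (hb' z).continuousAt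
  set v : X := y - x with hv
  set η : ℝ := f y - f x - L with hη
  have hηpos : 0 < η := by linarith
  have hLpos : 0 < L := (mul_nonneg hK (norm_nonneg v)).trans_lt hKL
  set s : ℝ → X := fun t => x + t • v with hs
  have hsc : Continuous s := by fun_prop
  have hseg : segment ℝ x y = s '' Set.Icc 0 1 := segment_eq_image' ℝ x y
  have hA : IsCompact (segment ℝ x y) := hseg ▸ isCompact_Icc.image hsc
  obtain ⟨m, hm⟩ := hf.exists_eventually_nhdsSet_le hΩ hA hxy
  have hy : ∀ᶠ z in 𝓝 y, f y - η / 2 < f z := by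
    have h1 := hf y (hxy (right_mem_segment ℝ x y)) (f y - η / 2) (by linarith)
    rwa [hΩ.nhdsWithin_eq (hxy (right_mem_segment ℝ x y))] at h1
  obtain ⟨r₁, hr₁, hball⟩ := Metric.eventually_nhds_iff.1 hy
  obtain ⟨r₂, hr₂, hthick⟩ := (Metric.hasBasis_nhdsSet_cthickening hA).eventually_iff.1
    (hm.and (hΩ.mem_nhdsSet.2 hxy))
  set r : ℝ := min r₁ r₂ with hr
  have hrpos : 0 < r := lt_min hr₁ hr₂
  set S : Set X := Metric.cthickening r (segment ℝ x y) with hS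
  have hSm : ∀ z ∈ S, m ≤ f z ∧ z ∈ Ω := fun z hz =>
    hthick (Metric.cthickening_mono (min_le_right _ _) _ hz)
  have hxS : x ∈ S := Metric.self_subset_cthickening _ (left_mem_segment ℝ x y)
  set M : ℝ := f x + L - m + η with hM
  have hMpos : 0 < M := by linarith [(hSm x hxS).1]
  set Φ : X → ℝ → ℝ := fun u t => -L * t + M * (1 - b (r⁻¹ • (u - s t))) with hΦ
  have hΦc : Continuous (Function.uncurry Φ) := by
    simp only [hΦ, Function.uncurry_def]
    fun_prop
  have hΦle : ∀ u, ∀ t ∈ Set.Icc (0 : ℝ) 1, -L ≤ Φ u t := by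
    intro u t ht
    have h1 := mul_nonneg hMpos.le (sub_nonneg.2 (hb1 (r⁻¹ • (u - s t))))
    have h2 := mul_le_of_le_one_right hLpos.le ht.2
    simp only [hΦ]
    linarith
  set ψ : X → ℝ := fun u => sInf (Φ u '' Set.Icc 0 1) with hψ
  have hψc : Continuous ψ := isCompact_Icc.continuous_sInf hΦc
  have hψmin : ∀ u, ∃ t ∈ Set.Icc (0 : ℝ) 1, ψ u = Φ u t := fun u => by
    obtain ⟨t, ht, h, -⟩ := isCompact_Icc.exists_sInf_image_eq_and_le (s := Set.Icc (0 : ℝ) 1)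
      (by simp) (f := Φ u) (hΦc.comp (Continuous.prodMk_right u)).continuousOn
    exact ⟨t, ht, h⟩
  have hψle : ∀ u, ∀ t ∈ Set.Icc (0 : ℝ) 1, ψ u ≤ Φ u t := fun u t ht =>
    csInf_le ⟨-L, by rintro _ ⟨t, ht, rfl⟩; exact hΦle u t ht⟩ ⟨t, ht, rfl⟩
  have hfS : LowerSemicontinuousOn (fun u => f u + ψ u) S :=
    (hf.mono fun z hz => (hSm z hz).2).add (hψc.lowerSemicontinuous.lowerSemicontinuousOn S)
  obtain ⟨ε, hε, hε1, hε2⟩ : ∃ ε > 0, ε ≤ η / 4 ∧ K * ‖v‖ + ε * ‖v‖ < L := by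
    have hlim : Tendsto (fun ε : ℝ => K * ‖v‖ + ε * ‖v‖) (𝓝[>] 0) (𝓝 (K * ‖v‖)) :=
      (Continuous.tendsto' (by fun_prop) _ _ (by simp)).mono_left nhdsWithin_le_nhds
    have h1 : ∀ᶠ ε : ℝ in 𝓝[>] 0, ε ≤ η / 4 :=
      nhdsWithin_le_nhds (Iic_mem_nhds (by linarith))
    obtain ⟨ε, h2, h3, h4⟩ := ((hlim.eventually (gt_mem_nhds hKL)).and
      (h1.and self_mem_nhdsWithin)).exists
    exact ⟨ε, h4, h3, h2⟩
  obtain ⟨g, g', hg', hgε, hg0, hgle, u, huS, hmin⟩ := hbump.exists_isMinOn_add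
    Metric.isClosed_cthickening ⟨x, hxS⟩ hfS (m := m + -L) (fun z hz => by
      obtain ⟨t, ht, h⟩ := hψmin z
      rw [h]
      exact add_le_add (hSm z hz).1 (hΦle z t ht)) hε
  obtain ⟨t, ht, hut⟩ := hψmin u
  have hΦx : Φ x 0 = 0 := by simp [hΦ, hs, hb00]
  have hle : f u + Φ u t ≤ f x + η / 4 := by
    have h1 := hmin x hxS
    have h2 := hψle x 0 (by simp)
    simp only [hut] at h1
    linarith [hg0 x, hgle u]
  have htube : ‖u - s t‖ < r := by
    by_contra! hge
    have h1 : b (r⁻¹ • (u - s t)) = 0 := hbs _ <| by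
      rw [norm_smul, norm_inv, Real.norm_of_nonneg hrpos.le]
      exact (one_le_inv_mul₀ hrpos).2 hge
    have h2 : Φ u t = -L * t + M := by simp [hΦ, h1]
    have h3 := mul_le_of_le_one_right hLpos.le ht.2
    linarith [(hSm u huS).1]
  have ht1 : t < 1 := by
    refine ht.2.lt_of_ne fun h => ?_
    have h1 : s t = y := by simp [hs, h, hv]
    have h2 : f y - η / 2 < f u := hball (by
      rw [dist_eq_norm, ← h1]
      exact htube.trans_le (min_le_left _ _))
    linarith [hΦle u t ht]
  have hΦt : HasDerivAt (Φ u) (-L + M * r⁻¹ * b' (r⁻¹ • (u - s t)) v) t := by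
    have h1 : HasDerivAt (fun t => r⁻¹ • (u - s t)) (r⁻¹ • -v) t := by
      have h2 : HasDerivAt s v t := by
        simpa only [one_smul, id] using ((hasDerivAt_id t).smul_const v).const_add x
      exact (h2.const_sub u).const_smul _
    have h3 := (((hb' _).comp_hasDerivAt t h1).const_sub 1).const_mul M
    refine (((hasDerivAt_id t).const_mul (-L)).add h3).congr_deriv ?_
    simp [mul_assoc]
  have hΦu : HasFDerivAt (fun z => Φ z t) (-(M * r⁻¹) • b' (r⁻¹ • (u - s t))) u := by
    have h1 : HasFDerivAt (fun z : X => r⁻¹ • (z - s t)) (r⁻¹ • ContinuousLinearMap.id ℝ X) u :=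
      ((hasFDerivAt_id u).sub_const (s t)).const_smul _
    refine ((((hb' _).comp u h1).const_sub 1).const_mul M |>.const_add (-L * t)).congr_fderiv ?_
    ext z
    simp [mul_assoc]
  have hslope : 0 ≤ -L + M * r⁻¹ * b' (r⁻¹ • (u - s t)) v := by
    refine ge_of_tendsto ((hasDerivWithinAt_iff_tendsto_slope' (s := Set.Ioi t) (by simp)).1
      hΦt.hasDerivWithinAt) ?_
    filter_upwards [Ioo_mem_nhdsGT ht1] with τ hτ
    rw [slope_def_field]
    refine div_nonneg (sub_nonneg.2 ?_) (sub_nonneg.2 hτ.1.le)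
    exact hut ▸ hψle u τ ⟨ht.1.trans hτ.1.le, hτ.2.le⟩
  have hSnhds : S ∈ 𝓝 u := by
    refine mem_of_superset (Metric.isOpen_thickening.mem_nhds ?_)
      (Metric.thickening_subset_cthickening r (segment ℝ x y))
    exact Metric.mem_thickening_iff.2 ⟨s t, hseg ▸ ⟨t, ht, rfl⟩, by rwa [dist_eq_norm]⟩
  have hloc : IsLocalMin (f + fun z => Φ z t + g z) u := by
    filter_upwards [hSnhds] with z hz
    have h1 := hmin z hz
    have h2 := hψle z t ht
    simp only [hut] at h1
    simp only [Pi.add_apply]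
    linarith
  have hξ := hsub u (hSm u huS).2 _ (hloc.neg_mem_subdiffOn (hΦu.add (hg' u)))
  have h1 := (le_abs_self _).trans (ContinuousLinearMap.le_of_opNorm_le _ hξ v)
  have h2 := (le_abs_self _).trans (ContinuousLinearMap.le_of_opNorm_le _ (hgε u) v)
  simp only [neg_add_rev, add_apply, neg_apply, smul_apply, smul_eq_mul] at h1
  linarith

theorem stmt6 [CompleteSpace X] (hbump : HasC1LipBump X)
    (p : X) (δ : ℝ) (hδ : 0 < δ) (K : ℝ) (hK : 0 ≤ K)
    (f : X → ℝ) (hf : LowerSemicontinuousOn f (Metric.ball p (4 * δ)))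
    (hsub : ∀ x ∈ Metric.ball p (4 * δ),
      ∀ ξ ∈ subdiffOn (Metric.ball p (4 * δ)) f x, ‖ξ‖ ≤ K) :
    ∀ x ∈ Metric.ball p δ, ∀ y ∈ Metric.ball p δ, |f x - f y| ≤ K * ‖x - y‖ := by
  intro x hx y hy
  have hsegment : ∀ {x y : X}, x ∈ Metric.ball p δ → y ∈ Metric.ball p δ →
      segment ℝ x y ⊆ Metric.ball p (4 * δ) := fun hx hy =>
    ((convex_ball p δ).segment_subset hx hy).trans (Metric.ball_subset_ball (by linarith))
  have h1 := sub_le_of_forall_subdiffOn_norm_le hbump Metric.isOpen_ball hK hf hsub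
    (hsegment hx hy)
  have h2 := sub_le_of_forall_subdiffOn_norm_le hbump Metric.isOpen_ball hK hf hsub
    (hsegment hy hx)
  rw [norm_sub_rev] at h1
  exact abs_sub_le_iff.2 ⟨h2, h1⟩
end

section
/- Let X be a real Banach space admitting a C¹ Lipschitz bump function and let Ω ⊆ X be open. Let 𝓕 be a nonempty family of upper semicontinuous functions from Ω into ℝ which is locally uniformly bounded (every point of Ω has a neighborhood on which the functions of 𝓕 are uniformly bounded), and let u = sup{v : v ∈ 𝓕} on Ω. Then for every x ∈ Ω and every Δ ∈ D⁺u*(x), there exist sequences (vₙ) in 𝓕, (xₙ) in Ω and Δₙ ∈ D⁺vₙ(xₙ) such that vₙ(xₙ) → u*(x), ‖xₙ − x‖ → 0 and ‖Δₙ − Δ‖ → 0. -/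
open Filter Topology

variable {X : Type*} [NormedAddCommGroup X] [NormedSpace ℝ X]

/-- The Fréchet superdifferential at `x` of a real-valued function `f` regarded as a
function defined on the set `Ω`. -/
def superdiffOn (Ω : Set X) (f : X → ℝ) (x : X) : Set (X →L[ℝ] ℝ) :=
  {Δ | ∀ ε > (0:ℝ), ∃ δ > (0:ℝ), ∀ h : X, ‖h‖ < δ → x + h ∈ Ω →
    f (x + h) ≤ f x + Δ h + ε * ‖h‖}

/-- The upper semicontinuous envelope on `Ω` of `u : Ω → ℝ`:
`u*(x) = lim_{r→0⁺} sup_{y ∈ B(x,r) ∩ Ω} u(y)`. -/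
noncomputable def uscEnv (Ω : Set X) (u : X → ℝ) (x : X) : ℝ :=
  Filter.limsup u (𝓝[Ω] x)

/-- A bump function can be normalised to take the value `1` at the origin, to vanish off the open
unit ball, and to be bounded together with its derivative by a common constant. -/
theorem HasC1LipBump.exists_normalized_s8
    (hbump : HasC1LipBump X) :
    ∃ (b : X → ℝ) (K : ℝ), 1 ≤ K ∧ Differentiable ℝ b ∧ (∀ h, ‖fderiv ℝ b h‖ ≤ K) ∧
      (∀ h, |b h| ≤ K) ∧ b 0 = 1 ∧ ∀ h, 1 ≤ ‖h‖ → b h = 0 := by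
  obtain ⟨b, hb, ⟨K, hK⟩, hbd, z, hz⟩ := hbump
  obtain ⟨R, hR0, hR⟩ := hbd.subset_ball_lt 0 z
  have hz' : b z ≠ 0 := hz
  set f : X → ℝ := fun h => (b z)⁻¹ * b (z + R • h) with hf
  have hfd : Differentiable ℝ f := by
    have h1 : Differentiable ℝ b := hb.differentiable (by norm_num)
    exact (h1.comp (g := b) (by fun_prop : Differentiable ℝ fun h : X => z + R • h)).const_mul _
  set C : NNReal := Real.toNNReal (|(b z)⁻¹| * (K * R)) with hC
  have hC' : (C : ℝ) = |(b z)⁻¹| * (K * R) := Real.coe_toNNReal _ (by positivity)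
  have hlip : LipschitzWith C f := by
    refine LipschitzWith.of_dist_le_mul fun x y => ?_
    have := hK.dist_le_mul (z + R • x) (z + R • y)
    rw [dist_add_left, dist_smul₀, Real.norm_of_nonneg hR0.le] at this
    rw [hC', Real.dist_eq, hf, ← mul_sub, abs_mul, ← Real.dist_eq]
    calc _ ≤ |(b z)⁻¹| * (K * (R * dist x y)) := by gcongr
      _ = _ := by ring
  have hf0 : f 0 = 1 := by simp [hf, hz']
  have hfs : ∀ h, 1 ≤ ‖h‖ → f h = 0 := by
    intro h hh
    have : z + R • h ∉ Function.support b := by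
      intro hmem
      have := hR hmem
      rw [Metric.mem_ball, dist_eq_norm, add_sub_cancel_left, norm_smul,
        Real.norm_of_nonneg hR0.le] at this
      nlinarith
    simp only [hf, Function.notMem_support.mp this, mul_zero]
  refine ⟨f, 1 + C, by simp, hfd, fun h => ?_, fun h => ?_, hf0, hfs⟩
  · have := norm_fderiv_le_of_lipschitz ℝ hlip (x₀ := h)
    linarith
  · by_cases hh : 1 ≤ ‖h‖
    · rw [hfs h hh, abs_zero]; positivity
    · have := hlip.dist_le_mul h 0
      rw [Real.dist_eq, dist_zero_right, hf0] at this
      have h2 : (C : ℝ) * ‖h‖ ≤ C * 1 := by gcongr; linarith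
      have := abs_le.1 this
      rw [abs_le]
      constructor <;> linarith [C.2, this.1, this.2]

theorem hasFDerivAt_const_mul_comp_inv_smul_sub {b : X → ℝ} (hb : Differentiable ℝ b) (c r : ℝ) (a y : X) :
    HasFDerivAt (fun y => c * b (r⁻¹ • (y - a)))
      ((c * r⁻¹) • fderiv ℝ b (r⁻¹ • (y - a))) y := by
  have h1 : HasFDerivAt (fun y : X => r⁻¹ • (y - a)) (r⁻¹ • ContinuousLinearMap.id ℝ X) y :=
    ((hasFDerivAt_id y).sub_const a).const_smul r⁻¹
  have h2 := (((hb _).hasFDerivAt (x := r⁻¹ • (y - a))).comp y h1).const_mul c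
  have h3 : (c * r⁻¹) • fderiv ℝ b (r⁻¹ • (y - a)) =
      c • (fderiv ℝ b (r⁻¹ • (y - a))).comp (r⁻¹ • ContinuousLinearMap.id ℝ X) := by
    ext h
    simp [mul_assoc]
  rw [h3]
  exact h2

theorem norm_const_mul_inv_smul_fderiv_le
    {b : X → ℝ} {K c r : ℝ} (hbK : ∀ h, ‖fderiv ℝ b h‖ ≤ K) (hc : 0 ≤ c) (hr : 0 ≤ r) (h : X) :
    ‖(c * r⁻¹) • fderiv ℝ b h‖ ≤ c * r⁻¹ * K := by
  rw [norm_smul, Real.norm_of_nonneg (by positivity)]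
  gcongr
  exact hbK h

/-- A real function bounded above on a nonempty set has approximate maximisers on it. -/
theorem exists_forall_lt_add_of_bddAbove {α : Type*} {D : Set α} (hD : D.Nonempty) {f : α → ℝ}
    (hf : BddAbove (f '' D)) {ε : ℝ} (hε : 0 < ε) :
    ∃ x ∈ D, ∀ y ∈ D, f y < f x + ε := by
  obtain ⟨_, ⟨x, hx, rfl⟩, h⟩ := exists_lt_of_lt_csSup (hD.image f)
    (sub_lt_self (sSup (f '' D)) hε)
  exact ⟨x, hx, fun y hy => by linarith [le_csSup hf (Set.mem_image_of_mem f hy)]⟩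

/-- Successively adding bumps centred at approximate maximisers. -/
theorem exists_seq_bump_centers
    {b : X → ℝ} {K : ℝ} (hK : ∀ h, |b h| ≤ K) {D : Set X} (hD : D.Nonempty) {g : X → ℝ}
    (hg : BddAbove (g '' D)) (c r : ℕ → ℝ) (hc : ∀ n, 0 < c n) :
    ∃ a : ℕ → X, ∀ n, a n ∈ D ∧ ∀ y ∈ D,
      g y + ∑ i ∈ Finset.range n, c i * b ((r i)⁻¹ • (y - a i)) <
        g (a n) + ∑ i ∈ Finset.range n, c i * b ((r i)⁻¹ • (a n - a i)) + c n / 2 := by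
  have : Nonempty X := ⟨0⟩
  choose! sel hsel using fun (n : ℕ) (f : X → ℝ) (hf : BddAbove (f '' D)) =>
    exists_forall_lt_add_of_bddAbove hD hf (half_pos (hc n))
  let φ : ℕ → X → ℝ := fun n => Nat.rec g
    (fun n f => fun y => f y + c n * b ((r n)⁻¹ • (y - sel n f))) n
  have hφ : ∀ n y, φ n y =
      g y + ∑ i ∈ Finset.range n, c i * b ((r i)⁻¹ • (y - sel i (φ i))) := by
    intro n
    induction n with
    | zero => intro y; simp [φ]
    | succ n ih =>
      intro y
      rw [Finset.sum_range_succ, ← add_assoc, ← ih]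
  have hbdd : ∀ n, BddAbove (φ n '' D) := by
    intro n
    induction n with
    | zero => exact hg
    | succ n ih =>
      obtain ⟨M, hM⟩ := ih
      refine ⟨M + c n * K, ?_⟩
      rintro _ ⟨y, hy, rfl⟩
      have h1 := hM (Set.mem_image_of_mem _ hy)
      have h2 := mul_le_mul_of_nonneg_left
        ((le_abs_self _).trans (hK ((r n)⁻¹ • (y - sel n (φ n))))) (hc n).le
      exact add_le_add h1 h2
  refine ⟨fun n => sel n (φ n), fun n => ⟨(hsel n _ (hbdd n)).1, fun y hy => ?_⟩⟩
  have := (hsel n _ (hbdd n)).2 y hy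
  rwa [hφ n y, hφ n (sel n (φ n))] at this

/-- If every point of `D` at distance at least `r n` from `a n` has a smaller value than `a n`,
then the `a n` converge to a maximiser. -/
theorem exists_isMaxOn_of_forall_lt {Y : Type*} [MetricSpace Y] [CompleteSpace Y] {D : Set Y}
    (hD : IsClosed D) {G : Y → ℝ} (hG : UpperSemicontinuousOn G D) {a : ℕ → Y} {r : ℕ → ℝ}
    (ha : ∀ n, a n ∈ D) (hr : Antitone r) (hr0 : Tendsto r atTop (𝓝 0))
    (h : ∀ n, ∀ y ∈ D, r n ≤ dist y (a n) → G y < G (a n)) :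
    ∃ z ∈ D, IsMaxOn G D z := by
  have hdist : ∀ n m, n ≤ m → dist (a m) (a n) < r n := by
    intro n m hnm
    by_contra! hcon
    have h1 := h n (a m) (ha m) hcon
    have h2 := h m (a n) (ha n) ((hr hnm).trans (by rwa [dist_comm]))
    exact lt_asymm h1 h2
  have hcau : CauchySeq a := Metric.cauchySeq_iff'.2 fun ε hε => by
    obtain ⟨N, hN⟩ := (hr0.eventually_lt_const hε).exists
    exact ⟨N, fun n hn => (hdist N n hn).trans hN⟩
  obtain ⟨z, hz⟩ := cauchySeq_tendsto_of_complete hcau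
  have hzD : z ∈ D := hD.mem_of_tendsto hz (Eventually.of_forall ha)
  refine ⟨z, hzD, fun y hy => ?_⟩
  change G y ≤ G z
  by_contra! hlt
  have hne : y ≠ z := by rintro rfl; exact lt_irrefl _ hlt
  have h1 : ∀ᶠ n in atTop, G (a n) < G y :=
    (tendsto_nhdsWithin_iff.2 ⟨hz, Eventually.of_forall ha⟩).eventually (hG z hzD _ hlt)
  have h2 : ∀ᶠ n in atTop, r n < dist y (a n) :=
    hr0.eventually_lt (tendsto_const_nhds.dist hz) (dist_pos.2 hne)
  obtain ⟨n, hn1, hn2⟩ := (h1.and h2).exists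
  exact lt_asymm hn1 (h n y hy hn2.le)

/-- Smooth variational principle: a bounded above upper semicontinuous function on a closed set
attains its maximum after a differentiable perturbation, small together with its derivative. -/
theorem exists_perturbation_isMaxOn
    [CompleteSpace X] {b : X → ℝ} {K : ℝ} (hK1 : 1 ≤ K) (hb : Differentiable ℝ b)
    (hbK : ∀ h, ‖fderiv ℝ b h‖ ≤ K) (hK : ∀ h, |b h| ≤ K) (hb0 : b 0 = 1)
    (hbs : ∀ h, 1 ≤ ‖h‖ → b h = 0) {D : Set X} (hDc : IsClosed D) (hD : D.Nonempty) {g : X → ℝ}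
    (hg : BddAbove (g '' D)) (husc : UpperSemicontinuousOn g D) {η : ℝ} (hη : 0 < η) :
    ∃ (p : X → ℝ) (p' : X → X →L[ℝ] ℝ), (∀ y, HasFDerivAt p (p' y) y) ∧ (∀ y, ‖p' y‖ ≤ η) ∧
      (∀ y, |p y| ≤ η) ∧ ∃ z ∈ D, IsMaxOn (fun y => g y + p y) D z := by
  have hK0 : 0 < K := by linarith
  set q : ℝ := (8 * K)⁻¹ with hq
  have hq0 : 0 < q := by positivity
  have hqK : q * K = 1 / 8 := by rw [hq]; field_simp
  have hq8 : q ≤ 1 / 8 := by nlinarith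
  set c₀ : ℝ := η / (2 * K) with hc₀
  have hc₀0 : 0 < c₀ := by positivity
  have hc₀K : c₀ * K = η / 2 := by rw [hc₀]; field_simp
  set c : ℕ → ℝ := fun n => c₀ * q ^ n with hc
  have hc0 : ∀ n, 0 < c n := fun n => by positivity
  set r : ℕ → ℝ := fun n => (1 / 2) ^ n with hr
  have hr0 : ∀ n, 0 < r n := fun n => by positivity
  obtain ⟨a, ha⟩ := exists_seq_bump_centers hK hD hg c r hc0
  set k : ℕ → X → ℝ := fun n y => c n * b ((r n)⁻¹ • (y - a n)) with hk
  set k' : ℕ → X → X →L[ℝ] ℝ :=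
    fun n y => (c n * (r n)⁻¹) • fderiv ℝ b ((r n)⁻¹ • (y - a n)) with hk'
  have hkb : ∀ n y, |k n y| ≤ c n * K := fun n y => by
    rw [hk, abs_mul, abs_of_pos (hc0 n)]
    exact mul_le_mul_of_nonneg_left (hK _) (hc0 n).le
  have hkshift : ∀ n i y, ‖k (i + n) y‖ ≤ c n * K * (1 / 8) ^ i := fun n i y => by
    refine (hkb _ _).trans ?_
    have : q ^ i ≤ (1 / 8) ^ i := by gcongr
    calc c (i + n) * K = c n * K * q ^ i := by simp only [hc]; ring
      _ ≤ _ := by gcongr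
  have hgeo : ∀ n, HasSum (fun i : ℕ => c n * K * (1 / 8 : ℝ) ^ i) (c n * K * (8 / 7)) := by
    intro n
    have := (hasSum_geometric_of_lt_one (r := (1 / 8 : ℝ)) (by norm_num) (by norm_num)).mul_left
      (c n * K)
    norm_num at this ⊢
    exact this
  have htail : ∀ n y, |∑' i, k (i + n) y| ≤ c n * K * (8 / 7) := fun n y =>
    tsum_of_norm_bounded (hgeo n) (fun i => hkshift n i y)
  have hsum : ∀ y, Summable fun n => k n y := fun y =>
    (hgeo 0).summable.of_norm_bounded (fun i => hkshift 0 i y)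
  have hk'b : ∀ n y, ‖k' n y‖ ≤ c₀ * K * (1 / 4) ^ n := fun n y => by
    refine (norm_const_mul_inv_smul_fderiv_le hbK (hc0 n).le (hr0 n).le _).trans ?_
    have h1 : c n * (r n)⁻¹ * K = c₀ * K * (q * 2) ^ n := by
      simp only [hc, hr, mul_pow, one_div, inv_pow, inv_inv]; ring
    rw [h1]
    gcongr
    linarith
  have hgeo' : HasSum (fun n : ℕ => c₀ * K * (1 / 4 : ℝ) ^ n) (c₀ * K * (4 / 3)) := by
    have := (hasSum_geometric_of_lt_one (r := (1 / 4 : ℝ)) (by norm_num) (by norm_num)).mul_left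
      (c₀ * K)
    norm_num at this ⊢
    exact this
  have hder : ∀ y, HasFDerivAt (fun y => ∑' n, k n y) (∑' n, k' n y) y := fun y =>
    hasFDerivAt_tsum hgeo'.summable
      (fun n y => hasFDerivAt_const_mul_comp_inv_smul_sub hb (c n) (r n) (a n) y) hk'b (hsum 0) y
  refine ⟨fun y => ∑' n, k n y, fun y => ∑' n, k' n y, hder, fun y => ?_, fun y => ?_, ?_⟩
  · refine (tsum_of_norm_bounded hgeo' (fun n => hk'b n y)).trans ?_
    linarith
  · refine (htail 0 y).trans ?_
    have : c 0 = c₀ := by simp [hc]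
    rw [this]; linarith
  · refine exists_isMaxOn_of_forall_lt hDc (a := a) (r := r) ?_ (fun n => (ha n).1)
      (pow_right_anti₀ (by norm_num) (by norm_num))
      (tendsto_pow_atTop_nhds_zero_of_lt_one (by norm_num) (by norm_num)) ?_
    · exact husc.add (fun y _ => (hder y).continuousAt.continuousWithinAt.upperSemicontinuousWithinAt)
    · intro n y hy hdist
      have hsplit : ∀ w, ∑' m, k m w =
          ∑ i ∈ Finset.range n, k i w + k n w + ∑' i, k (i + (n + 1)) w := fun w => by
        rw [← (hsum w).sum_add_tsum_nat_add (n + 1), Finset.sum_range_succ]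
      have hky : k n y = 0 := by
        simp only [hk]
        rw [hbs, mul_zero]
        rw [norm_smul, norm_inv, Real.norm_of_nonneg (hr0 n).le, ← dist_eq_norm]
        rw [inv_mul_eq_div, one_le_div (hr0 n)]
        exact hdist
      have hka : k n (a n) = c n := by simp [hk, hb0]
      have hcn : c (n + 1) * K = c n / 8 := by
        calc c (n + 1) * K = c n * (q * K) := by simp only [hc]; ring
          _ = _ := by rw [hqK]; ring
      have h1 := abs_le.1 (htail (n + 1) y)
      have h2 := abs_le.1 (htail (n + 1) (a n))
      rw [hcn] at h1 h2
      have h3 := (ha n).2 y hy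
      change g y + ∑ i ∈ Finset.range n, k i y <
        g (a n) + ∑ i ∈ Finset.range n, k i (a n) + c n / 2 at h3
      change g y + ∑' m, k m y < g (a n) + ∑' m, k m (a n)
      rw [hsplit y, hsplit (a n), hky, hka]
      linarith [h1.2, h2.1, hc0 n]

theorem mem_superdiffOn_of_isLocalMax_sub
    {Ω : Set X} {v q : X → ℝ} {L : X →L[ℝ] ℝ} {z : X} (hq : HasFDerivAt q L z)
    (hmax : IsLocalMax (fun y => v y - q y) z) : L ∈ superdiffOn Ω v z := by
  intro ε hε
  obtain ⟨δ, hδ, h⟩ := Metric.eventually_nhds_iff.1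
    ((hq.isLittleO.def hε).and hmax)
  refine ⟨δ, hδ, fun h' hh' _ => ?_⟩
  obtain ⟨h1, h2⟩ := h (y := z + h') (by simpa [dist_eq_norm] using hh')
  rw [add_sub_cancel_left, Real.norm_eq_abs] at h1
  have := (abs_le.1 h1).2
  linarith

/-- Single-scale form of `stmt8`. -/
theorem exists_mem_superdiffOn_near
    [CompleteSpace X] (hbump : HasC1LipBump X)
    {Ω : Set X} (hΩ : IsOpen Ω) {F : Set (X → ℝ)}
    (husc : ∀ v ∈ F, UpperSemicontinuousOn v Ω) {w : X → ℝ}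
    (hle : ∀ v ∈ F, ∀ y ∈ Ω, v y ≤ w y) {x : X} (hx : x ∈ Ω)
    (hfreq : ∀ η > 0, ∃ᶠ y in 𝓝 x, ∃ v ∈ F, w x - η < v y)
    {Δ : X →L[ℝ] ℝ} (hΔ : Δ ∈ superdiffOn Ω w x) {ε : ℝ} (hε : 0 < ε) :
    ∃ v ∈ F, ∃ z ∈ Ω, ∃ L ∈ superdiffOn Ω v z, |v z - w x| < ε ∧ ‖z - x‖ < ε ∧ ‖L - Δ‖ < ε := by
  obtain ⟨b, K, hK1, hb, hbK, hK, hb0, hbs⟩ := hbump.exists_normalized_s8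
  obtain ⟨e, he0, he⟩ : ∃ e > 0, e * (2 * K + 1) < ε :=
    ⟨ε / (2 * (2 * K + 1)), by positivity, by field_simp; linarith⟩
  obtain ⟨δ, hδ, hδΔ⟩ := hΔ e he0
  obtain ⟨ρ, hρ, hρΩ⟩ := Metric.isOpen_iff.1 hΩ x hx
  have hN : 0 < ‖Δ‖ + e * (2 * K + 1) + 1 := by positivity
  obtain ⟨r, hr0, hr⟩ := exists_between (a₁ := 0)
    (a₂ := min (min δ ρ) (min 1 (ε / (‖Δ‖ + e * (2 * K + 1) + 1)))) (by positivity)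
  simp only [lt_min_iff] at hr
  obtain ⟨⟨hrδ, hrρ⟩, hr1, hrε⟩ := hr
  rw [lt_div_iff₀ hN] at hrε
  have her : 0 < e * r := by positivity
  have hDΩ : Metric.closedBall x r ⊆ Ω := (Metric.closedBall_subset_ball hrρ).trans hρΩ
  have hup : ∀ v ∈ F, ∀ y ∈ Metric.closedBall x r, v y ≤ w x + Δ (y - x) + e * r := by
    intro v hv y hy
    have hyr : ‖y - x‖ ≤ r := by simpa [dist_eq_norm] using hy
    have h1 := hδΔ (y - x) (hyr.trans_lt hrδ) (by simpa using hDΩ hy)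
    rw [add_sub_cancel] at h1
    have h2 := hle v hv y (hDΩ hy)
    have h3 : e * ‖y - x‖ ≤ e * r := by gcongr
    linarith
  have hΔle : ∀ y ∈ Metric.closedBall x r, |Δ (y - x)| ≤ ‖Δ‖ * r := by
    intro y hy
    have hyr : ‖y - x‖ ≤ r := by simpa [dist_eq_norm] using hy
    exact (Δ.le_opNorm _).trans (by gcongr)
  set B : X → ℝ := fun y => 2 * e * r * b (r⁻¹ • (y - x)) with hB
  have hBd : ∀ y, HasFDerivAt B ((2 * e * r * r⁻¹) • fderiv ℝ b (r⁻¹ • (y - x))) y := fun y =>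
    hasFDerivAt_const_mul_comp_inv_smul_sub hb (2 * e * r) r x y
  have hBx : B x = 2 * (e * r) := by simp [hB, hb0]; ring
  have hBle : ∀ y, |B y| ≤ 2 * (e * r) * K := fun y => by
    rw [hB, abs_mul, abs_of_pos (by positivity), mul_assoc 2]
    gcongr
    exact hK _
  have hBc : Continuous B := continuous_iff_continuousAt.2 fun y => (hBd y).continuousAt
  have hlc : Continuous fun y => Δ (y - x) := by fun_prop
  have hev1 : ∀ᶠ y in 𝓝 x, 3 / 2 * (e * r) < B y :=
    hBc.continuousAt.eventually_const_lt (by rw [hBx]; linarith)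
  have hev2 : ∀ᶠ y in 𝓝 x, Δ (y - x) < e * r / 8 :=
    hlc.continuousAt.eventually_lt_const (by simp; positivity)
  obtain ⟨y₀, ⟨v, hv, hy₀v⟩, hy₀B, hy₀Δ, hy₀⟩ := ((hfreq (e * r / 8) (by positivity)).and_eventually
    (hev1.and (hev2.and (Metric.closedBall_mem_nhds x hr0)))).exists
  set g : X → ℝ := fun y => v y + (B y - Δ (y - x)) with hg
  have hgb : BddAbove (g '' Metric.closedBall x r) := by
    refine ⟨w x + e * r + 2 * (e * r) * K, ?_⟩
    rintro _ ⟨y, hy, rfl⟩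
    have := hup v hv y hy
    have := (abs_le.1 (hBle y)).2
    simp only [hg]
    linarith
  have hgu : UpperSemicontinuousOn g (Metric.closedBall x r) :=
    ((husc v hv).mono hDΩ).add
      ((hBc.sub hlc).upperSemicontinuous.upperSemicontinuousOn _)
  obtain ⟨p, p', hp, hp', hpb, z, hz, hmax⟩ := exists_perturbation_isMaxOn hK1 hb hbK hK hb0 hbs
    Metric.isClosed_closedBall ⟨y₀, hy₀⟩ hgb hgu (η := e * r / 16) (by positivity)
  have hcmp : g y₀ + p y₀ ≤ g z + p z := hmax hy₀
  have hpz := abs_le.1 (hpb z)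
  have hpy := abs_le.1 (hpb y₀)
  have hupz := hup v hv z hz
  have hzball : z ∈ Metric.ball x r := by
    by_contra hcon
    have hBz : B z = 0 := by
      simp only [hB]
      rw [hbs, mul_zero]
      rw [norm_smul, norm_inv, Real.norm_of_nonneg hr0.le, ← dist_eq_norm, inv_mul_eq_div,
        one_le_div hr0]
      simpa using hcon
    simp only [hg] at hcmp
    linarith
  have hzr : ‖z - x‖ < r := by simpa [dist_eq_norm] using hzball
  have hBz := abs_le.1 (hBle z)
  have hΔz := abs_le.1 (hΔle z hz)
  refine ⟨v, hv, z, hDΩ hz,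
    Δ - (2 * e * r * r⁻¹) • fderiv ℝ b (r⁻¹ • (z - x)) - p' z, ?_, ?_, ?_, ?_⟩
  · refine mem_superdiffOn_of_isLocalMax_sub (q := fun y => Δ (y - x) - B y - p y) ?_ ?_
    · have h1 : HasFDerivAt (fun y => Δ (y - x)) Δ z := by
        exact Δ.hasFDerivAt.comp z ((hasFDerivAt_id z).sub_const x)
      exact (h1.sub (hBd z)).sub (hp z)
    · have := hmax.isLocalMax (Metric.closedBall_mem_nhds_of_mem hzball)
      filter_upwards [this] with y hy
      simp only [hg] at hy
      linarith
  · simp only [hg] at hcmp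
    rw [abs_lt]
    constructor <;> nlinarith
  · have : 0 ≤ r * (‖Δ‖ + e * (2 * K + 1)) := by positivity
    linarith
  · have h1 := norm_const_mul_inv_smul_fderiv_le (c := 2 * e * r) hbK (by positivity) hr0.le
      (r⁻¹ • (z - x))
    have h2 : 2 * e * r * r⁻¹ * K = 2 * e * K := by field_simp
    have h3 := hp' z
    rw [h2] at h1
    rw [show ∀ A C : X →L[ℝ] ℝ, Δ - A - C - Δ = -(A + C) by intros; abel, norm_neg]
    refine (norm_add_le _ _).trans_lt ?_
    nlinarith

theorem stmt8 [CompleteSpace X] (hbump : HasC1LipBump X)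
    (Ω : Set X) (hΩ : IsOpen Ω) (F : Set (X → ℝ)) (hFne : F.Nonempty)
    (husc : ∀ v ∈ F, UpperSemicontinuousOn v Ω)
    (hbdd : ∀ x ∈ Ω, ∃ U ∈ 𝓝 x, ∃ C : ℝ, ∀ v ∈ F, ∀ y ∈ U ∩ Ω, |v y| ≤ C)
    (u : X → ℝ) (hu : ∀ y ∈ Ω, IsLUB ((fun v : X → ℝ => v y) '' F) (u y))
    (x : X) (hx : x ∈ Ω) (Δ : X →L[ℝ] ℝ)
    (hΔ : Δ ∈ superdiffOn Ω (uscEnv Ω u) x) :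
    ∃ (v : ℕ → X → ℝ) (xs : ℕ → X) (Δs : ℕ → X →L[ℝ] ℝ),
      (∀ n, v n ∈ F) ∧ (∀ n, xs n ∈ Ω) ∧
      (∀ n, Δs n ∈ superdiffOn Ω (v n) (xs n)) ∧
      Tendsto (fun n => v n (xs n)) atTop (𝓝 (uscEnv Ω u x)) ∧
      Tendsto (fun n => ‖xs n - x‖) atTop (𝓝 0) ∧
      Tendsto (fun n => ‖Δs n - Δ‖) atTop (𝓝 0) := by
  have hbd : ∀ y ∈ Ω, ∃ C : ℝ, ∀ᶠ y' in 𝓝[Ω] y, |u y'| ≤ C := by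
    intro y hy
    obtain ⟨U, hU, C, hC⟩ := hbdd y hy
    refine ⟨C, ?_⟩
    filter_upwards [mem_nhdsWithin_of_mem_nhds hU, self_mem_nhdsWithin] with y' hy'U hy'Ω
    obtain ⟨v, hv⟩ := hFne
    refine abs_le.2 ⟨?_, (hu y' hy'Ω).2 ?_⟩
    · exact (abs_le.1 (hC v hv y' ⟨hy'U, hy'Ω⟩)).1.trans
        ((hu y' hy'Ω).1 (Set.mem_image_of_mem _ hv))
    · rintro _ ⟨v', hv', rfl⟩
      exact (abs_le.1 (hC v' hv' y' ⟨hy'U, hy'Ω⟩)).2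
  have hle : ∀ v ∈ F, ∀ y ∈ Ω, v y ≤ uscEnv Ω u y := by
    intro v hv y hy
    obtain ⟨C, hC⟩ := hbd y hy
    refine ((hu y hy).1 (Set.mem_image_of_mem _ hv)).trans ?_
    refine le_limsup_of_frequently_le (fun h => ?_)
      ⟨C, eventually_map.2 (hC.mono fun _ h => (abs_le.1 h).2)⟩
    exact (h.self_of_nhdsWithin hy) le_rfl
  have hfreq : ∀ η > 0, ∃ᶠ y in 𝓝 x, ∃ v ∈ F, uscEnv Ω u x - η < v y := by
    intro η hη
    obtain ⟨C, hC⟩ := hbd x hx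
    have hne : (𝓝[Ω] x).NeBot := by rw [hΩ.nhdsWithin_eq hx]; infer_instance
    have hcob : IsCoboundedUnder (· ≤ ·) (𝓝[Ω] x) u := IsBoundedUnder.isCoboundedUnder_le
      ⟨-C, eventually_map.2 (hC.mono fun _ h => (abs_le.1 h).1)⟩
    have h1 := frequently_lt_of_lt_limsup hcob (sub_lt_self (uscEnv Ω u x) hη)
    have h2 := h1.and_eventually self_mem_nhdsWithin
    rw [hΩ.nhdsWithin_eq hx] at h2
    refine h2.mono fun y hy => ?_
    obtain ⟨_, ⟨v, hv, rfl⟩, h⟩ := (lt_isLUB_iff (hu y hy.2)).1 hy.1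
    exact ⟨v, hv, h⟩
  choose v hv xs hxs Δs hΔs h1 h2 h3 using fun n : ℕ =>
    exists_mem_superdiffOn_near hbump hΩ husc hle hx hfreq hΔ (Nat.one_div_pos_of_nat (α := ℝ) (n := n))
  have h0 := tendsto_one_div_add_atTop_nhds_zero_nat (𝕜 := ℝ)
  refine ⟨v, xs, Δs, hv, hxs, hΔs, ?_, ?_, ?_⟩
  · exact tendsto_iff_dist_tendsto_zero.2
      (squeeze_zero (fun _ => dist_nonneg) (fun n => (h1 n).le) h0)
  · exact squeeze_zero (fun _ => norm_nonneg _) (fun n => (h2 n).le) h0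
  · exact squeeze_zero (fun _ => norm_nonneg _) (fun n => (h3 n).le) h0
end
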